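/- Let (X,d) be a compact metric space and f : X → X a Lipschitz continuous map. Then for every α ≥ 0 and every integer k ≥ 1, the estimation entropy satisfies the power rule h_est(kα, X; f^k) = k · h_est(α, X; f). -/

import Mathlib

open Filter Metric Set

/-- Minimal cardinality of an `(n,ε,α,K)`-spanning set for `g`. -/
noncomputable def spanNum {X : Type*} [MetricSpace X] (g : X → X) (K : Set X)
    (α : ℝ) (n : ℕ) (ε : ℝ) : ℕ :=
  sInf {m : ℕ | ∃ S : Finset X, ↑S ⊆ K ∧ S.card = m ∧
    ∀ x ∈ K, ∃ y ∈ S, ∀ t : ℕ, t ≤ n →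
      dist (g^[t] x) (g^[t] y) < ε * Real.exp (-α * t)}

/-- Estimation entropy of `g` on `K` with exponent `α` (base-2 logarithm); the limit
as `ε ↓ 0` is realized as the supremum over `ε > 0`, by monotonicity. -/
noncomputable def estEntropy {X : Type*} [MetricSpace X] (g : X → X) (K : Set X)
    (α : ℝ) : EReal :=
  ⨆ ε ∈ Set.Ioi (0 : ℝ),
    atTop.limsup fun n : ℕ => ((Real.logb 2 (spanNum g K α n ε) / n : ℝ) : EReal)

/-- On a compact space every continuous map admits a finite spanning set. -/
theorem exists_spanning_finset {X : Type*} [MetricSpace X] [CompactSpace X] {g : X → X}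
    (hg : Continuous g) (α : ℝ) (n : ℕ) {ε : ℝ} (hε : 0 < ε) :
    ∃ S : Finset X, ∀ x, ∃ y ∈ S, ∀ t : ℕ, t ≤ n →
      dist (g^[t] x) (g^[t] y) < ε * Real.exp (-α * t) := by
  obtain ⟨S, hS⟩ := CompactSpace.elim_nhds_subcover
    (fun y => ⋂ t ∈ Set.Iic n, {x | dist (g^[t] x) (g^[t] y) < ε * Real.exp (-α * t)})
    (fun y => (biInter_mem (Set.finite_Iic n)).2 fun t _ =>
      (isOpen_lt ((hg.iterate t).dist continuous_const) continuous_const).mem_nhds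
        (by simpa using by positivity))
  refine ⟨S, fun x => ?_⟩
  have hx : x ∈ (⊤ : Set X) := trivial
  rw [← hS] at hx
  simpa using hx

/-- If spanning sets for `h` are spanning sets for `g`, then the spanning numbers compare. -/
theorem spanNum_univ_le {X : Type*} [MetricSpace X] [CompactSpace X] {g h : X → X}
    (hh : Continuous h) {α β : ℝ} {m n : ℕ} {ε δ : ℝ} (hδ : 0 < δ)
    (H : ∀ x y, (∀ t : ℕ, t ≤ n → dist (h^[t] x) (h^[t] y) < δ * Real.exp (-β * t)) →
      ∀ t : ℕ, t ≤ m → dist (g^[t] x) (g^[t] y) < ε * Real.exp (-α * t)) :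
    spanNum g Set.univ α m ε ≤ spanNum h Set.univ β n δ := by
  obtain ⟨S₀, hS₀⟩ := exists_spanning_finset hh β n hδ
  obtain ⟨S, -, hcard, hS⟩ := Nat.sInf_mem (s := {m : ℕ | ∃ S : Finset X, (S : Set X) ⊆ Set.univ ∧
    S.card = m ∧ ∀ x ∈ Set.univ, ∃ y ∈ S, ∀ t : ℕ, t ≤ n →
      dist (h^[t] x) (h^[t] y) < δ * Real.exp (-β * t)})
    ⟨_, S₀, Set.subset_univ _, rfl, fun x _ => hS₀ x⟩
  refine Nat.sInf_le ⟨S, Set.subset_univ _, hcard, fun x hx => ?_⟩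
  obtain ⟨y, hy, hxy⟩ := hS x hx
  exact ⟨y, hy, H x y hxy⟩

theorem spanNum_iterate_le {X : Type*} [MetricSpace X] [CompactSpace X] {f : X → X}
    (hf : Continuous f) (α : ℝ) (k n : ℕ) {ε : ℝ} (hε : 0 < ε) :
    spanNum f^[k] Set.univ (k * α) n ε ≤ spanNum f Set.univ α (k * n) ε := by
  refine spanNum_univ_le hf hε fun x y hxy t ht => ?_
  have := hxy (k * t) (Nat.mul_le_mul_left k ht)
  rw [← Function.iterate_mul]
  convert this using 3
  push_cast
  ring

theorem spanNum_mul_le_iterate {X : Type*} [MetricSpace X] [CompactSpace X] {f : X → X}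
    {L : NNReal} (hf : LipschitzWith L f) {α : ℝ} (hα : 0 ≤ α) {k : ℕ} (hk : 1 ≤ k) (n : ℕ)
    {ε : ℝ} (hε : 0 < ε) :
    spanNum f Set.univ α (k * n) ε ≤
      spanNum f^[k] Set.univ (k * α) n (ε / (max (L : ℝ) 1 ^ k * Real.exp (α * k))) := by
  set M : ℝ := max (L : ℝ) 1 with hM
  have hM1 : 1 ≤ M := le_max_right _ _
  refine spanNum_univ_le (hf.continuous.iterate k) (by positivity) fun x y hxy s hs => ?_
  have hst : s % k + k * (s / k) = s := Nat.mod_add_div s k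
  have hr : s % k < k := Nat.mod_lt _ hk
  have ht : s / k ≤ n := Nat.div_le_of_le_mul hs
  have hd := hxy _ ht
  generalize s % k = r at *
  generalize s / k = t at *
  subst hst
  rw [← Function.iterate_mul] at hd
  rw [Function.iterate_add_apply, Function.iterate_add_apply]
  have hLM : ((L ^ r : NNReal) : ℝ) ≤ M ^ k := by
    push_cast
    exact (pow_le_pow_left₀ L.coe_nonneg (le_max_left _ _) r).trans
      (pow_le_pow_right₀ hM1 hr.le)
  calc dist (f^[r] (f^[k * t] x)) (f^[r] (f^[k * t] y))
      ≤ (L ^ r : NNReal) * dist (f^[k * t] x) (f^[k * t] y) := (hf.iterate r).dist_le_mul _ _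
    _ ≤ M ^ k * dist (f^[k * t] x) (f^[k * t] y) := by gcongr
    _ < M ^ k * (ε / (M ^ k * Real.exp (α * k)) * Real.exp (-(k * α) * t)) := by gcongr
    _ = ε * Real.exp (-(k * α) * t - α * k) := by
      rw [Real.exp_sub]
      field_simp
    _ ≤ ε * Real.exp (-α * ↑(r + k * t)) := by
      gcongr
      push_cast
      have : α * r ≤ α * k := by gcongr
      linarith

theorem logb_two_natCast_mono : Monotone fun n : ℕ => Real.logb 2 n := by
  intro m n hmn
  rcases Nat.eq_zero_or_pos m with rfl | hm
  · rcases Nat.eq_zero_or_pos n with rfl | hn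
    · rfl
    · simpa using Real.logb_nonneg one_lt_two (show (1 : ℝ) ≤ n by exact_mod_cast hn)
  · exact Real.logb_le_logb_of_le one_lt_two (by positivity) (by exact_mod_cast hmn)

/-- Sampling along multiples of `k` multiplies the linear growth rate by at most `k`. -/
theorem limsup_comp_mul_div_le (u : ℕ → ℝ) {k : ℕ} (hk : 1 ≤ k) :
    atTop.limsup (fun n : ℕ => ((u (k * n) / n : ℝ) : EReal)) ≤
      k * atTop.limsup (fun n : ℕ => ((u n / n : ℝ) : EReal)) := by
  have hk0 : (0 : EReal) < k := by exact_mod_cast hk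
  have hkR : (0 : ℝ) < k := by exact_mod_cast hk
  have hkt : (k : EReal) ≠ ⊤ := EReal.natCast_ne_top k
  rw [← EReal.div_le_iff_le_mul hk0 hkt]
  refine EReal.le_of_forall_lt_iff_le.1 fun z hz => ?_
  rw [EReal.div_le_iff_le_mul hk0 hkt]
  have hev := (tendsto_id.const_mul_atTop' (r := k) hk).eventually (eventually_lt_of_limsup_lt hz)
  refine limsup_le_of_le (by isBoundedDefault) ?_
  filter_upwards [hev, eventually_gt_atTop 0] with n hn hn0
  have hnR : (0 : ℝ) < n := by exact_mod_cast hn0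
  have h : u (k * n) / ((k * n : ℕ) : ℝ) < z := by exact_mod_cast hn
  have h' : u (k * n) / n ≤ k * z := by
    push_cast at h
    rw [div_lt_iff₀ (by positivity)] at h
    rw [div_le_iff₀ hnR]
    linarith
  exact_mod_cast h'

/-- For monotone sequences, sampling along multiples of `k` multiplies the linear growth rate
by at least `k`. -/
theorem Monotone.mul_limsup_div_le {u : ℕ → ℝ} (hu : Monotone u) {k : ℕ} (hk : 1 ≤ k) :
    k * atTop.limsup (fun n : ℕ => ((u n / n : ℝ) : EReal)) ≤
      atTop.limsup (fun n : ℕ => ((u (k * n) / n : ℝ) : EReal)) := by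
  have hk0 : (0 : EReal) < k := by exact_mod_cast hk
  have hkR : (0 : ℝ) < k := by exact_mod_cast hk
  have hkt : (k : EReal) ≠ ⊤ := EReal.natCast_ne_top k
  refine EReal.le_of_forall_lt_iff_le.1 fun z hz => ?_
  rw [mul_comm, ← EReal.le_div_iff_mul_le hk0 hkt]
  have hev : ∀ᶠ m : ℕ in atTop, u (k * (m / k + 1)) / ((m / k + 1 : ℕ) : ℝ) < z := by
    have := ((tendsto_add_atTop_nat 1).comp
      (Nat.tendsto_div_const_atTop (by omega : k ≠ 0))).eventually (eventually_lt_of_limsup_lt hz)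
    filter_upwards [this] with m hm
    exact_mod_cast hm
  have hle : ∀ᶠ m : ℕ in atTop,
      ((u m / m : ℝ) : EReal) ≤ ((z / k + |z| / m : ℝ) : EReal) := by
    filter_upwards [hev, eventually_gt_atTop 0] with m hm hm0
    have hmR : (0 : ℝ) < m := by exact_mod_cast hm0
    have hmod : ((m % k : ℕ) : ℝ) + k * ((m / k : ℕ) : ℝ) = m := by
      exact_mod_cast Nat.mod_add_div m k
    have hr : ((m % k : ℕ) : ℝ) ≤ k := by exact_mod_cast (Nat.mod_lt m hk).le
    have hr0 : (0 : ℝ) ≤ ((m % k : ℕ) : ℝ) := Nat.cast_nonneg _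
    have hmu : u m ≤ u (k * (m / k + 1)) := hu (Nat.lt_mul_div_succ m hk).le
    rw [div_lt_iff₀ (by positivity)] at hm
    push_cast at hm
    rw [EReal.coe_le_coe_iff, div_le_iff₀ hmR]
    have hq : (((m / k : ℕ) : ℝ) + 1) = m / k + (k - ((m % k : ℕ) : ℝ)) / k := by
      field_simp
      linarith
    have hs0 : 0 ≤ (k - ((m % k : ℕ) : ℝ)) / k := div_nonneg (by linarith) hkR.le
    have hs1 : (k - ((m % k : ℕ) : ℝ)) / k ≤ 1 := (div_le_one hkR).2 (by linarith)
    have hz1 : z * ((k - ((m % k : ℕ) : ℝ)) / k) ≤ |z| := by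
      nlinarith [le_abs_self z, abs_nonneg z]
    rw [hq] at hm
    have : (z / k + |z| / m) * m = z * (m / k) + |z| := by field_simp
    linarith
  have hlim : Tendsto (fun m : ℕ => ((z / k + |z| / m : ℝ) : EReal)) atTop
      (nhds ((z / k : ℝ) : EReal)) := by
    refine (continuous_coe_real_ereal.tendsto _).comp ?_
    simpa using (tendsto_const_div_atTop_nhds_zero_nat |z|).const_add (z / k)
  refine (limsup_le_limsup hle).trans ?_
  rw [hlim.limsup_eq]
  exact (EReal.coe_div z k).le

/-- For a Lipschitz continuous map `f` on a compact metric space `X`,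
every `α ≥ 0` and every integer `k ≥ 1`, the power rule
`h_est(kα, X; f^k) = k · h_est(α, X; f)` holds. -/
theorem estimation_entropy_power_rule {X : Type*} [MetricSpace X] [CompactSpace X]
    (f : X → X) (hf : ∃ L : NNReal, LipschitzWith L f)
    (α : ℝ) (hα : 0 ≤ α) (k : ℕ) (hk : 1 ≤ k) :
    estEntropy f^[k] Set.univ (k * α) = (k : EReal) * estEntropy f Set.univ α := by
  obtain ⟨L, hL⟩ := hf
  have hk0 : (0 : EReal) < k := by exact_mod_cast hk
  have hkt : (k : EReal) ≠ ⊤ := EReal.natCast_ne_top k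
  apply le_antisymm
  · refine iSup₂_le fun ε hε => ?_
    calc _ ≤ atTop.limsup fun n : ℕ =>
          ((Real.logb 2 (spanNum f Set.univ α (k * n) ε) / n : ℝ) : EReal) := by
          refine limsup_le_limsup (Eventually.of_forall fun n => ?_)
          exact EReal.coe_le_coe_iff.2 (div_le_div_of_nonneg_right
            (logb_two_natCast_mono (spanNum_iterate_le hL.continuous α k n hε)) n.cast_nonneg)
      _ ≤ k * atTop.limsup fun n : ℕ =>
          ((Real.logb 2 (spanNum f Set.univ α n ε) / n : ℝ) : EReal) :=
        limsup_comp_mul_div_le (fun n => Real.logb 2 (spanNum f Set.univ α n ε)) hk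
      _ ≤ _ := mul_le_mul_of_nonneg_left (le_iSup₂_of_le ε hε le_rfl) hk0.le
  · rw [mul_comm, ← EReal.le_div_iff_mul_le hk0 hkt]
    refine iSup₂_le fun ε hε => ?_
    rw [EReal.le_div_iff_mul_le hk0 hkt, mul_comm]
    have hε' : 0 < ε := hε
    have hmono : Monotone fun n => Real.logb 2 (spanNum f Set.univ α n ε) := fun m n hmn =>
      logb_two_natCast_mono (spanNum_univ_le hL.continuous hε'
        fun x y hxy t ht => hxy t (ht.trans hmn))
    refine (hmono.mul_limsup_div_le hk).trans ?_
    refine le_iSup₂_of_le (ε / (max (L : ℝ) 1 ^ k * Real.exp (α * k)))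
      (show (0 : ℝ) < _ by positivity) ?_
    refine limsup_le_limsup (Eventually.of_forall fun n => ?_)
    exact EReal.coe_le_coe_iff.2 (div_le_div_of_nonneg_right
      (logb_two_natCast_mono (spanNum_mul_le_iterate hL hα hk n hε')) n.cast_nonneg)
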